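/- For a, m > 0, the Abel-regularized integral lim_{ε→0⁺} ∫_0^∞ e^{−εp} · p sin(a p)/√(p² + m²) dp equals m K_1(a m), where K_1 is the modified Bessel function of the second kind of order 1. -/

import Mathlib

open Real Filter Set Topology MeasureTheory

/-- Modified Bessel function of the second kind of order 1, for `x > 0`:
`K₁(x) = ∫_0^∞ e^{−x cosh t} cosh t dt`. -/
noncomputable def besselK1 (x : ℝ) : ℝ :=
  ∫ t in Ioi (0 : ℝ), Real.exp (-x * Real.cosh t) * Real.cosh t

theorem Real.tendsto_sinh_atTop : Tendsto Real.sinh atTop atTop :=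
  tendsto_atTop_mono' _ (eventually_ge_atTop 0 |>.mono fun _ hx => Real.self_le_sinh_iff.2 hx)
    tendsto_id

theorem tendsto_exp_neg_mul_sinh_mul_cosh {δ : ℝ} (hδ : 0 < δ) :
    Tendsto (fun t : ℝ => Real.exp (-δ * Real.sinh t) * Real.cosh t) atTop (𝓝 0) := by
  have hpow (n : ℝ) := (tendsto_rpow_mul_exp_neg_mul_atTop_nhds_zero n δ hδ).comp
    Real.tendsto_sinh_atTop
  have hlim := (hpow 0).add (hpow 1)
  rw [add_zero] at hlim
  refine squeeze_zero' (Eventually.of_forall fun t => by positivity) ?_ hlim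
  filter_upwards [eventually_ge_atTop 0] with t ht
  have h1 : Real.cosh t ≤ 1 + Real.sinh t := by
    have := Real.cosh_sub_sinh t
    have := Real.exp_le_one_iff.2 (neg_nonpos.2 ht)
    linarith
  simp only [Function.comp, Real.rpow_zero, Real.rpow_one]
  nlinarith [Real.exp_pos (-δ * Real.sinh t)]

theorem integrableOn_exp_neg_mul_sinh_mul_cosh {δ : ℝ} (hδ : 0 < δ) :
    IntegrableOn (fun t : ℝ => Real.exp (-δ * Real.sinh t) * Real.cosh t) (Ioi 0) := by
  have hlim : Tendsto (fun t : ℝ => -δ⁻¹ * Real.exp (-δ * Real.sinh t)) atTop (𝓝 (-δ⁻¹ * 0)) :=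
    (Real.tendsto_exp_atBot.comp (Real.tendsto_sinh_atTop.const_mul_atTop_of_neg
      (neg_lt_zero.2 hδ))).const_mul _
  refine integrableOn_Ioi_deriv_of_nonneg' (fun t _ => ?_) (fun t _ => by positivity) hlim
  exact ((Real.hasDerivAt_sinh t).const_mul (-δ)).exp.const_mul (-δ⁻¹) |>.congr_deriv
    (by field_simp)

theorem Complex.norm_sinh_le_cosh_re (w : ℂ) : ‖Complex.sinh w‖ ≤ Real.cosh w.re := by
  rw [Complex.sinh, Real.cosh_eq, norm_div, Complex.norm_ofNat]
  gcongr
  refine (norm_sub_le _ _).trans_eq ?_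
  simp [Complex.norm_exp]

theorem norm_exp_neg_mul_sinh_mul_sinh_le {z : ℂ} {δ : ℝ} (hre : δ ≤ z.re) (him : δ ≤ -z.im)
    (hδ : 0 ≤ δ) {t θ : ℝ} (ht : 0 ≤ t) (hθ : θ ∈ Icc 0 (π / 2)) :
    ‖Complex.exp (-z * Complex.sinh (t + θ * Complex.I)) * Complex.sinh (t + θ * Complex.I)‖ ≤
      Real.exp (-δ * Real.sinh t) * Real.cosh t := by
  have hs : 0 ≤ Real.sin θ := Real.sin_nonneg_of_nonneg_of_le_pi hθ.1 (by linarith [hθ.2, pi_pos])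
  have hc : 0 ≤ Real.cos θ := Real.cos_nonneg_of_neg_pi_div_two_le_of_le
    (by linarith [hθ.1, pi_pos]) hθ.2
  have hsc : 1 ≤ Real.cos θ + Real.sin θ := by
    nlinarith [Real.sin_sq_add_cos_sq θ, mul_nonneg hs hc]
  have hsh : 0 ≤ Real.sinh t := Real.sinh_nonneg_iff.2 ht
  have hz : 0 ≤ -z.im := hδ.trans him
  have hch : Real.sinh t ≤ Real.cosh t := (Real.sinh_lt_cosh t).le
  rw [norm_mul, Complex.norm_exp]
  gcongr
  · have : Complex.sinh (t + θ * Complex.I) =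
        (Real.sinh t * Real.cos θ : ℝ) + (Real.cosh t * Real.sin θ : ℝ) * Complex.I := by
      rw [Complex.sinh_add, Complex.cosh_mul_I, Complex.sinh_mul_I]
      push_cast
      ring
    rw [this]
    simp only [Complex.mul_re, Complex.neg_re, Complex.neg_im, Complex.add_re, Complex.add_im,
      Complex.ofReal_re, Complex.ofReal_im, Complex.I_re, Complex.I_im, Complex.mul_im]
    have h1 : δ * (Real.sinh t * Real.cos θ) ≤ z.re * (Real.sinh t * Real.cos θ) := by gcongr
    have h2 : δ * (Real.sinh t * Real.sin θ) ≤ -z.im * (Real.cosh t * Real.sin θ) := by gcongr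
    have h3 : δ * Real.sinh t * 1 ≤ δ * Real.sinh t * (Real.cos θ + Real.sin θ) := by gcongr
    linarith
  · simpa using Complex.norm_sinh_le_cosh_re (t + θ * Complex.I)

theorem integral_exp_neg_mul_sinh_mul_sinh {z : ℂ} (hre : 0 < z.re) (him : z.im < 0) :
    IntegrableOn (fun t : ℝ => Complex.exp (-z * Complex.sinh t) * Complex.sinh t) (Ioi 0) ∧
    IntegrableOn (fun t : ℝ => Complex.exp (-z * (Complex.cosh t * Complex.I)) *
      (Complex.cosh t * Complex.I)) (Ioi 0) ∧
    ∫ t in Ioi (0 : ℝ), Complex.exp (-z * Complex.sinh t) * Complex.sinh t =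
      (∫ t in Ioi (0 : ℝ), Complex.exp (-z * (Complex.cosh t * Complex.I)) *
        (Complex.cosh t * Complex.I)) -
      ∫ θ in (0 : ℝ)..π / 2, Complex.exp (-z * (Complex.sin θ * Complex.I)) * Complex.sin θ := by
  obtain ⟨δ, hδ, hδre, hδim⟩ : ∃ δ, 0 < δ ∧ δ ≤ z.re ∧ δ ≤ -z.im :=
    ⟨min z.re (-z.im), lt_min hre (by linarith), min_le_left _ _, min_le_right _ _⟩
  set f : ℂ → ℂ := fun w => Complex.exp (-z * Complex.sinh w) * Complex.sinh w with hf
  have hfd : Differentiable ℂ f := by fun_prop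
  have hfc := hfd.continuous
  have hbd {t θ : ℝ} (ht : 0 ≤ t) (hθ : θ ∈ Icc 0 (π / 2)) :
      ‖f (t + θ * Complex.I)‖ ≤ Real.exp (-δ * Real.sinh t) * Real.cosh t :=
    norm_exp_neg_mul_sinh_mul_sinh_le hδre hδim hδ.le ht hθ
  have hint {θ : ℝ} (hθ : θ ∈ Icc 0 (π / 2)) :
      IntegrableOn (fun t : ℝ => f (t + θ * Complex.I)) (Ioi 0) := by
    refine (integrableOn_exp_neg_mul_sinh_mul_cosh hδ).mono'
      (by fun_prop : Continuous fun t : ℝ => f (t + θ * Complex.I)).aestronglyMeasurable ?_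
    exact (ae_restrict_mem measurableSet_Ioi).mono fun t ht => hbd (le_of_lt ht) hθ
  have hpi : (0 : ℝ) ≤ π / 2 := by positivity
  have hbottom (t : ℝ) : f (t + (0 : ℝ) * Complex.I) =
      Complex.exp (-z * Complex.sinh t) * Complex.sinh t := by simp [hf]
  have hshift (t : ℝ) : Complex.sinh (t + (π / 2 : ℝ) * Complex.I) =
      Complex.cosh t * Complex.I := by
    rw [Complex.sinh_add, Complex.cosh_mul_I, Complex.sinh_mul_I]
    simp
  have htop (t : ℝ) : f (t + (π / 2 : ℝ) * Complex.I) =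
      Complex.exp (-z * (Complex.cosh t * Complex.I)) * (Complex.cosh t * Complex.I) := by
    simp only [hf, hshift]
  have hleft (θ : ℝ) : f ((0 : ℝ) + θ * Complex.I) =
      Complex.exp (-z * (Complex.sin θ * Complex.I)) * Complex.sin θ * Complex.I := by
    simp only [hf, Complex.ofReal_zero, zero_add, Complex.sinh_mul_I]
    ring
  have hint0 := hint (left_mem_Icc.2 hpi)
  have hint1 := hint (right_mem_Icc.2 hpi)
  have hright : Tendsto (fun T : ℝ => ∫ θ in (0 : ℝ)..π / 2, f (T + θ * Complex.I)) atTop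
      (𝓝 0) := by
    have hlim := (tendsto_exp_neg_mul_sinh_mul_cosh hδ).mul_const |π / 2 - 0|
    rw [zero_mul] at hlim
    refine squeeze_zero_norm' ?_ hlim
    filter_upwards [eventually_ge_atTop 0] with T hT
    refine intervalIntegral.norm_integral_le_of_norm_le_const fun θ hθ => hbd hT ?_
    rw [uIoc_of_le hpi] at hθ
    exact Ioc_subset_Icc_self hθ
  have hrect (T : ℝ) := Complex.integral_boundary_rect_eq_zero_of_differentiableOn f 0
    (T + (π / 2 : ℝ) * Complex.I) hfd.differentiableOn
  have hlim := (((intervalIntegral_tendsto_integral_Ioi 0 hint0 tendsto_id).sub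
    (intervalIntegral_tendsto_integral_Ioi 0 hint1 tendsto_id)).add
    (hright.const_smul Complex.I)).sub_const
    (Complex.I • ∫ θ in (0 : ℝ)..π / 2, f ((0 : ℝ) + θ * Complex.I))
  have hzero := tendsto_nhds_unique (hlim.congr fun T => by
    have := hrect T
    simpa using this) tendsto_const_nhds
  simp only [hbottom, htop, hleft, intervalIntegral.integral_mul_const] at hzero hint0 hint1
  refine ⟨hint0, hint1, ?_⟩
  simp only [smul_eq_mul, mul_zero, add_zero] at hzero
  linear_combination hzero + (∫ θ in (0 : ℝ)..π / 2,
    Complex.exp (-z * (Complex.sin θ * Complex.I)) * Complex.sin θ) * Complex.I_sq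

theorem integral_exp_mul_sin_div_sqrt_eq_sinh (a m ε : ℝ) (hm : 0 < m) :
    ∫ p in Ioi (0 : ℝ),
        Real.exp (-ε * p) * (p * Real.sin (a * p) / Real.sqrt (p ^ 2 + m ^ 2)) =
      m * ∫ t in Ioi (0 : ℝ), Real.exp (-(ε * m) * Real.sinh t) *
        Real.sin (a * m * Real.sinh t) * Real.sinh t := by
  have himage : (fun t => m * Real.sinh t) '' Ioi 0 = Ioi 0 := by
    ext p
    constructor
    · rintro ⟨t, ht, rfl⟩
      exact mul_pos hm (Real.sinh_pos_iff.2 ht)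
    · intro hp
      exact ⟨Real.arsinh (p / m), Real.arsinh_pos_iff.2 (div_pos hp hm), by
        simp only [Real.sinh_arsinh]; field_simp⟩
  have hinj : InjOn (fun t => m * Real.sinh t) (Ioi 0) := fun x _ y _ h =>
    Real.sinh_injective (mul_left_cancel₀ hm.ne' h)
  have hsub := integral_image_eq_integral_abs_deriv_smul measurableSet_Ioi
    (fun t _ => ((Real.hasDerivAt_sinh t).const_mul m).hasDerivWithinAt) hinj
    (fun p => Real.exp (-ε * p) * (p * Real.sin (a * p) / Real.sqrt (p ^ 2 + m ^ 2)))
  rw [himage] at hsub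
  rw [hsub, ← integral_const_mul]
  refine integral_congr_ae (Eventually.of_forall fun t => ?_)
  have hsqrt : Real.sqrt ((m * Real.sinh t) ^ 2 + m ^ 2) = m * Real.cosh t := by
    rw [show (m * Real.sinh t) ^ 2 + m ^ 2 = (m * Real.cosh t) ^ 2 by
      rw [mul_pow, mul_pow, Real.cosh_sq]; ring]
    exact Real.sqrt_sq (by positivity)
  have hcosh := Real.cosh_pos t
  simp only [hsqrt, smul_eq_mul, abs_of_pos (mul_pos hm hcosh)]
  rw [show -ε * (m * Real.sinh t) = -(ε * m) * Real.sinh t by ring,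
    show a * (m * Real.sinh t) = a * m * Real.sinh t by ring]
  field_simp

theorem integral_exp_mul_sin_mul_sinh {α β : ℝ} (hα : 0 < α) (hβ : 0 < β) :
    ∫ t in Ioi (0 : ℝ), Real.exp (-β * Real.sinh t) * Real.sin (α * Real.sinh t) * Real.sinh t =
      (∫ t in Ioi (0 : ℝ), Real.exp (-α * Real.cosh t) * Real.cosh t *
        Real.cos (β * Real.cosh t)) +
      ∫ θ in (0 : ℝ)..π / 2, Real.exp (-α * Real.sin θ) * Real.sin θ *
        Real.sin (β * Real.sin θ) := by
  obtain ⟨h0, h1, h⟩ := integral_exp_neg_mul_sinh_mul_sinh (z := ⟨β, -α⟩) hβ (neg_lt_zero.2 hα)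
  have him := congrArg Complex.im h
  rw [Complex.sub_im, intervalIntegral.integral_of_le (by positivity)] at him
  have h2 : IntegrableOn (fun θ : ℝ => Complex.exp (-(⟨β, -α⟩ : ℂ) *
      (Complex.sin θ * Complex.I)) * Complex.sin θ) (Ioc 0 (π / 2)) :=
    ((by fun_prop : Continuous fun θ : ℝ => Complex.exp (-(⟨β, -α⟩ : ℂ) *
      (Complex.sin θ * Complex.I)) * Complex.sin θ).integrableOn_Icc).mono_set Ioc_subset_Icc_self
  have im_integral {s : Set ℝ} {g : ℝ → ℂ} (hg : IntegrableOn g s) :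
      (∫ t in s, g t).im = ∫ t in s, (g t).im := (integral_im (𝕜 := ℂ) hg).symm
  rw [im_integral h0, im_integral h1, im_integral h2] at him
  rw [intervalIntegral.integral_of_le (by positivity)]
  simp only [← Complex.ofReal_sinh, ← Complex.ofReal_cosh, ← Complex.ofReal_sin,
    Complex.mul_im, Complex.mul_re, Complex.exp_re, Complex.exp_im, Complex.neg_re,
    Complex.neg_im, Complex.ofReal_re, Complex.ofReal_im, Complex.I_re, Complex.I_im, mul_zero,
    mul_one, sub_zero, add_zero, zero_add, neg_neg, neg_mul, Real.sin_neg,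
    Real.cos_neg, mul_neg, integral_neg, sub_neg_eq_add] at him ⊢
  rw [him]
  congr 1 <;> exact integral_congr_ae (Eventually.of_forall fun _ => mul_right_comm _ _ _)

theorem tendsto_integral_exp_mul_cosh_mul_cos {α : ℝ} (hα : 0 < α) :
    Tendsto (fun β : ℝ => ∫ t in Ioi (0 : ℝ), Real.exp (-α * Real.cosh t) * Real.cosh t *
      Real.cos (β * Real.cosh t)) (𝓝 0) (𝓝 (besselK1 α)) := by
  refine tendsto_integral_filter_of_dominated_convergence
    (fun t => Real.exp (-α * Real.sinh t) * Real.cosh t)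
    (Eventually.of_forall fun β => (by fun_prop : Continuous fun t : ℝ =>
      Real.exp (-α * Real.cosh t) * Real.cosh t * Real.cos (β * Real.cosh t)).aestronglyMeasurable)
    (Eventually.of_forall fun β => Eventually.of_forall fun t => ?_)
    (integrableOn_exp_neg_mul_sinh_mul_cosh hα) (Eventually.of_forall fun t => ?_)
  · have hcosh := Real.cosh_pos t
    rw [norm_mul, norm_mul, Real.norm_of_nonneg (Real.exp_pos _).le,
      Real.norm_of_nonneg hcosh.le]
    refine (mul_le_of_le_one_right (by positivity) (Real.abs_cos_le_one _)).trans ?_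
    have := (Real.sinh_lt_cosh t).le
    gcongr ?_ * _
    exact Real.exp_le_exp.2 (by nlinarith)
  · have hc : Continuous fun β : ℝ => Real.exp (-α * Real.cosh t) * Real.cosh t *
      Real.cos (β * Real.cosh t) := by fun_prop
    simpa using hc.tendsto 0

theorem tendsto_integral_exp_mul_sin_mul_sin (α : ℝ) :
    Tendsto (fun β : ℝ => ∫ θ in (0 : ℝ)..π / 2, Real.exp (-α * Real.sin θ) * Real.sin θ *
      Real.sin (β * Real.sin θ)) (𝓝 0) (𝓝 0) := by
  have hc : Continuous (fun β : ℝ => ∫ θ in (0 : ℝ)..π / 2, Real.exp (-α * Real.sin θ) *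
      Real.sin θ * Real.sin (β * Real.sin θ)) :=
    intervalIntegral.continuous_parametric_intervalIntegral_of_continuous' (by fun_prop) _ _
  simpa using hc.tendsto 0

theorem abel_regularized_integral_eq_besselK1 (a m : ℝ) (ha : 0 < a) (hm : 0 < m) :
    Tendsto
      (fun ε : ℝ =>
        ∫ p in Ioi (0 : ℝ),
          Real.exp (-ε * p) * (p * Real.sin (a * p) / Real.sqrt (p ^ 2 + m ^ 2)))
      (𝓝[>] 0) (𝓝 (m * besselK1 (a * m))) := by
  have hα := mul_pos ha hm
  have hscale : Tendsto (fun ε : ℝ => ε * m) (𝓝[>] 0) (𝓝 0) := by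
    have hc : Continuous fun ε : ℝ => ε * m := by fun_prop
    simpa using (hc.tendsto 0).mono_left nhdsWithin_le_nhds
  have hlim := (((tendsto_integral_exp_mul_cosh_mul_cos hα).add
    (tendsto_integral_exp_mul_sin_mul_sin (a * m))).comp hscale).const_mul m
  rw [add_zero] at hlim
  refine hlim.congr' ?_
  filter_upwards [self_mem_nhdsWithin] with ε hε
  rw [integral_exp_mul_sin_div_sqrt_eq_sinh a m ε hm,
    integral_exp_mul_sin_mul_sinh hα (mul_pos hε hm)]
  rfl
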